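/- Define four three-qutrit vectors, each supported on an affine plane and with amplitude (1/3)·ω^{Q(w)} at the indicated points: σ₁ at points (w₀,2,w₁) with Q₁(w) = w₀² + w₀w₁; σ₃ at points (w₀,2,w₁) with Q₃(w) = w₀² + 2w₀w₁; σ₂ at points (w₀,1,w₁) with Q₂(w) = 2w₀² + w₀w₁ + w₁²; σ₄ at points (w₀,1,w₁) with Q₄(w) = 2w₀² + 2w₀w₁ + w₁² (w ∈ 𝔽₃², exponents mod 3, amplitude 0 elsewhere). With α = (3√2 − i√6)/8 and β = −i√6/4, one has |𝕊⟩^{⊗3} = α(σ₁ − σ₃) + β(σ₂ − σ₄). All four σⱼ are canonical 3-qutrit stabilizer states, so χ(|𝕊⟩^{⊗3}) ≤ 4. -/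

import Mathlib

open Complex
open scoped BigOperators

noncomputable section

/-- An `m`-qutrit state is a vector of amplitudes indexed by `Fin m → ZMod 3`. -/
abbrev QS (m : ℕ) := (Fin m → ZMod 3) → ℂ

/-- The primitive cube root of unity `ω = exp(2πi/3)`. -/
def ω : ℂ := Complex.exp (2 * Real.pi * Complex.I / 3)

/-- `ω` raised to an exponent in `ZMod 3`. -/
def ωp (a : ZMod 3) : ℂ := ω ^ a.val

/-- A polynomial `Q : 𝔽₃^k → 𝔽₃` of degree at most 2. -/
def IsDeg2 {k : ℕ} (Q : (Fin k → ZMod 3) → ZMod 3) : Prop :=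
  ∃ (A : Fin k → Fin k → ZMod 3) (b : Fin k → ZMod 3) (c : ZMod 3),
    ∀ y, Q y = (∑ i, ∑ j, A i j * y i * y j) + (∑ i, b i * y i) + c

/-- `σ` is a canonical `m`-qutrit stabilizer state:
`σ = 3^{-k/2} ∑_{y ∈ 𝔽₃^k} ω^{Q(y)} |x₀ + W y⟩` with `W` injective linear and `deg Q ≤ 2`. -/
def IsStab {m : ℕ} (σ : QS m) : Prop :=
  ∃ k : ℕ, k ≤ m ∧
    ∃ (x₀ : Fin m → ZMod 3)
      (W : (Fin k → ZMod 3) →ₗ[ZMod 3] (Fin m → ZMod 3))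
      (Q : (Fin k → ZMod 3) → ZMod 3),
      Function.Injective W ∧ IsDeg2 Q ∧
      σ = fun x => ((Real.sqrt (3 ^ k) : ℝ) : ℂ)⁻¹ *
        ∑ y : Fin k → ZMod 3, if x = x₀ + W y then ωp (Q y) else 0

/-- The stabilizer rank: the least `r` such that `ψ` is a ℂ-linear combination of `r`
canonical stabilizer states. -/
def stabRank {m : ℕ} (ψ : QS m) : ℕ :=
  sInf {r : ℕ | ∃ (c : Fin r → ℂ) (σ : Fin r → QS m),
    (∀ i, IsStab (σ i)) ∧ ψ = ∑ i, c i • σ i}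

/-- The `m`-fold tensor power of a single-qutrit state. -/
def tpow (ψ : ZMod 3 → ℂ) (m : ℕ) : QS m := fun x => ∏ i, ψ (x i)

/-- The Strange state `|𝕊⟩ = (|1⟩ - |2⟩)/√2`. -/
def Strange : ZMod 3 → ℂ := fun j =>
  ((if j = 1 then 1 else 0) - (if j = 2 then 1 else 0)) / (Real.sqrt 2 : ℂ)

/-- `σ₁`: supported on `(w₀, 2, w₁)` with `Q₁(w) = w₀² + w₀w₁`. -/
def σT1 : QS 3 := fun x =>
  if x 1 = 2 then (1 / 3 : ℂ) * ωp (x 0 ^ 2 + x 0 * x 2) else 0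

/-- `σ₃`: supported on `(w₀, 2, w₁)` with `Q₃(w) = w₀² + 2w₀w₁`. -/
def σT3 : QS 3 := fun x =>
  if x 1 = 2 then (1 / 3 : ℂ) * ωp (x 0 ^ 2 + 2 * x 0 * x 2) else 0

/-- `σ₂`: supported on `(w₀, 1, w₁)` with `Q₂(w) = 2w₀² + w₀w₁ + w₁²`. -/
def σT2 : QS 3 := fun x =>
  if x 1 = 1 then (1 / 3 : ℂ) * ωp (2 * x 0 ^ 2 + x 0 * x 2 + x 2 ^ 2) else 0

/-- `σ₄`: supported on `(w₀, 1, w₁)` with `Q₄(w) = 2w₀² + 2w₀w₁ + w₁²`. -/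
def σT4 : QS 3 := fun x =>
  if x 1 = 1 then (1 / 3 : ℂ) * ωp (2 * x 0 ^ 2 + 2 * x 0 * x 2 + x 2 ^ 2) else 0

/-- The linear inclusion `(w₀, w₁) ↦ (w₀, 0, w₁)` of the coordinate plane. -/
def planeIncl : (Fin 2 → ZMod 3) →ₗ[ZMod 3] (Fin 3 → ZMod 3) where
  toFun y := ![y 0, 0, y 1]
  map_add' y z := by ext i; fin_cases i <;> simp
  map_smul' a y := by ext i; fin_cases i <;> simp

lemma eq_add_planeIncl_iff (c : ZMod 3) (x : Fin 3 → ZMod 3) (y : Fin 2 → ZMod 3) :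
    x = ![0, c, 0] + planeIncl y ↔ ![x 0, x 2] = y ∧ x 1 = c := by
  simp only [funext_iff, Fin.forall_fin_succ, planeIncl]
  simp
  tauto

lemma planeIncl_injective : Function.Injective planeIncl := by
  intro y z h
  have h0 := congrFun h 0
  have h2 := congrFun h 2
  ext i
  fin_cases i
  · simpa [planeIncl] using h0
  · simpa [planeIncl] using h2

/-- A homogeneous quadratic phase on the affine plane `x₁ = c` is a stabilizer state. -/
lemma isStab_plane (c p q r : ZMod 3) :
    IsStab (fun x : Fin 3 → ZMod 3 =>
      if x 1 = c then (1 / 3 : ℂ) * ωp (p * x 0 ^ 2 + q * x 0 * x 2 + r * x 2 ^ 2) else 0) := by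
  refine ⟨2, by norm_num, ![0, c, 0], planeIncl,
    fun y => p * y 0 ^ 2 + q * y 0 * y 1 + r * y 1 ^ 2, planeIncl_injective, ?_, ?_⟩
  · refine ⟨![![p, q], ![0, r]], 0, 0, fun y => ?_⟩
    simp [Fin.sum_univ_two]
    ring
  · funext x
    have h3 : Real.sqrt (3 ^ 2) = 3 := Real.sqrt_sq (by norm_num)
    simp only [eq_add_planeIncl_iff, ite_and, Finset.sum_ite_eq, Finset.mem_univ, if_true, h3]
    split_ifs <;> simp

lemma isStab_σT1 : IsStab σT1 := by
  convert isStab_plane 2 1 1 0 using 1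
  funext x
  simp [σT1]

lemma isStab_σT2 : IsStab σT2 := by
  convert isStab_plane 1 2 1 1 using 1
  funext x
  simp [σT2]

lemma isStab_σT3 : IsStab σT3 := by
  convert isStab_plane 2 1 2 0 using 1
  funext x
  simp [σT3]

lemma isStab_σT4 : IsStab σT4 := by
  convert isStab_plane 1 2 2 1 using 1
  funext x
  simp [σT4]

lemma ω_eq : ω = -1 / 2 + (Real.sqrt 3 : ℂ) / 2 * Complex.I := by
  have h : (2 * Real.pi * Complex.I / 3 : ℂ) =
      ((Real.pi - Real.pi / 3 : ℝ) : ℂ) * Complex.I := by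
    push_cast
    ring
  rw [ω, h, Complex.exp_mul_I, ← Complex.ofReal_cos, ← Complex.ofReal_sin, Real.cos_pi_sub,
    Real.sin_pi_sub, Real.cos_pi_div_three, Real.sin_pi_div_three]
  push_cast
  ring

lemma ωp_zero : ωp 0 = 1 := by simp [ωp]

lemma ωp_one : ωp 1 = -1 / 2 + (Real.sqrt 3 : ℂ) / 2 * Complex.I := by
  rw [← ω_eq]
  exact pow_one ω

lemma ofReal_sqrt_sq {t : ℝ} (ht : 0 ≤ t) : (Real.sqrt t : ℂ) ^ 2 = t := by
  exact_mod_cast Real.sq_sqrt ht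

lemma ωp_two : ωp 2 = -1 / 2 - (Real.sqrt 3 : ℂ) / 2 * Complex.I := by
  have h3 : (Real.sqrt 3 : ℂ) ^ 2 = 3 := by exact_mod_cast ofReal_sqrt_sq (t := 3) (by norm_num)
  change ω ^ 2 = _
  rw [ω_eq]
  linear_combination (Complex.I ^ 2 / 4) * h3 + (3 / 4 : ℂ) * Complex.I_sq

lemma tpow_Strange_three :
    tpow Strange 3 =
      ((((3 * Real.sqrt 2 : ℝ) : ℂ) - Complex.I * (Real.sqrt 6 : ℂ)) / 8) • (σT1 - σT3) +
      (-(Complex.I * (Real.sqrt 6 : ℂ)) / 4) • (σT2 - σT4) := by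
  have h2 : (Real.sqrt 2 : ℂ) ^ 2 = 2 := by exact_mod_cast ofReal_sqrt_sq (t := 2) (by norm_num)
  have h3 : (Real.sqrt 3 : ℂ) ^ 2 = 3 := by exact_mod_cast ofReal_sqrt_sq (t := 3) (by norm_num)
  have h6 : (Real.sqrt 6 : ℂ) = Real.sqrt 2 * Real.sqrt 3 := by
    rw [← Complex.ofReal_mul, ← Real.sqrt_mul (by norm_num)]
    norm_num
  have hinv : (Real.sqrt 2 : ℂ)⁻¹ = Real.sqrt 2 / 2 := by
    rw [inv_eq_of_mul_eq_one_right]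
    linear_combination h2 / 2
  funext x
  simp only [tpow, Strange, Fin.prod_univ_three, Pi.add_apply, Pi.smul_apply, Pi.sub_apply,
    smul_eq_mul, σT1, σT2, σT3, σT4, h6, div_eq_mul_inv _ (Real.sqrt 2 : ℂ), hinv]
  have hI := Complex.I_sq
  push_cast
  generalize x 0 = a, x 1 = b, x 2 = c
  generalize (Real.sqrt 2 : ℂ) = s at *
  have hs : s ^ 3 = 2 * s := by linear_combination s * h2
  have d01 : (0 : ZMod 3) ≠ 1 := by decide
  have d02 : (0 : ZMod 3) ≠ 2 := by decide
  have d12 : (1 : ZMod 3) ≠ 2 := by decide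
  have cases3 : ∀ t : ZMod 3, t = 0 ∨ t = 1 ∨ t = 2 := by decide
  rcases cases3 b with rfl | rfl | rfl
  · simp [d01, d02]
  all_goals
    rcases cases3 a with rfl | rfl | rfl <;> rcases cases3 c with rfl | rfl | rfl <;>
    simp only [d01, d02, d12, d12.symm, if_true, if_false] <;> norm_num <;>
    (try reduce_mod_char) <;> (try simp only [ωp_zero, ωp_one, ωp_two]) <;> ring_nf <;>
    (try simp only [hs, hI, h3]) <;> ring

/-- with `α = (3√2 - i√6)/8` and `β = -i√6/4`,
`|𝕊⟩^{⊗3} = α(σ₁ - σ₃) + β(σ₂ - σ₄)`; all four are canonical 3-qutrit stabilizer states,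
so `χ(|𝕊⟩^{⊗3}) ≤ 4`. -/
theorem strange_m3_decomposition :
    tpow Strange 3 =
      ((((3 * Real.sqrt 2 : ℝ) : ℂ) - Complex.I * (Real.sqrt 6 : ℂ)) / 8) • (σT1 - σT3) +
      (-(Complex.I * (Real.sqrt 6 : ℂ)) / 4) • (σT2 - σT4) ∧
    IsStab σT1 ∧ IsStab σT2 ∧ IsStab σT3 ∧ IsStab σT4 ∧
    stabRank (tpow Strange 3) ≤ 4 := by
  refine ⟨tpow_Strange_three, isStab_σT1, isStab_σT2, isStab_σT3, isStab_σT4, Nat.sInf_le ?_⟩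
  refine ⟨![(((3 * Real.sqrt 2 : ℝ) : ℂ) - Complex.I * (Real.sqrt 6 : ℂ)) / 8,
      -((((3 * Real.sqrt 2 : ℝ) : ℂ) - Complex.I * (Real.sqrt 6 : ℂ)) / 8),
      -(Complex.I * (Real.sqrt 6 : ℂ)) / 4, -(-(Complex.I * (Real.sqrt 6 : ℂ)) / 4)],
    ![σT1, σT3, σT2, σT4], fun i => ?_, ?_⟩
  · fin_cases i
    exacts [isStab_σT1, isStab_σT3, isStab_σT2, isStab_σT4]
  · rw [tpow_Strange_three]
    simp only [Fin.sum_univ_four, Matrix.cons_val]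
    module
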